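/- Let A be a continuous compactly supported vector field on ℝⁿ (n ≥ 3), δ > 0, and suppose that for every affine 2-plane P whose tangent space is within distance δ of a fixed 2-plane direction, and every vector ξ tangent to P, one has ∫_P ξ·A dλ_P = 0. Then dA = 0 on ℝⁿ, where A is viewed as the 1-form Σ A_j dx_j. -/

import Mathlib

open MeasureTheory
open scoped RealInnerProductSpace

noncomputable section

abbrev En (n : ℕ) := EuclideanSpace ℝ (Fin n)

def pdR {n : ℕ} (j : Fin n) (f : En n → ℝ) (x : En n) : ℝ :=
  fderiv ℝ f x (EuclideanSpace.single j 1)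

open Complex in
def Hat {n : ℕ} (A : En n → En n) (u k : En n) : ℂ :=
  ∫ x, cexp (((-2 * Real.pi * ⟪x, k⟫ : ℝ) : ℂ) * I) * ((⟪u, A x⟫ : ℝ) : ℂ)

def gg (x : ℝ) : ℝ := max 0 (1 - |x|)

lemma gg_cont : Continuous gg := by unfold gg; fun_prop

lemma gg_supp {x : ℝ} (h : 1 < |x|) : gg x = 0 := by
  unfold gg; rw [max_eq_left]; linarith

lemma gg_int : (∫ x, gg x) ≠ 0 := by
  have hc : HasCompactSupport gg := by
    refine HasCompactSupport.intro (isCompact_closedBall (0:ℝ) 1) ?_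
    intro x hx
    apply gg_supp
    simpa using hx
  have := gg_cont.integral_pos_of_hasCompactSupport_nonneg_nonzero (μ := volume) hc
    (x := 0) (fun x => le_max_left _ _) (by simp [gg])
  exact this.ne'

open Complex in
lemma plane_hat {n : ℕ} (A : En n → En n) (hA : Continuous A) (hAc : HasCompactSupport A)
    (v w k ξ : En n) (hv : ‖v‖ = 1) (hw : ‖w‖ = 1) (hvw : ⟪v, w⟫ = 0)
    (hkv : ⟪v, k⟫ = 0) (hkw : ⟪w, k⟫ = 0)
    (h : ∀ p : En n, ∫ st : ℝ × ℝ, ⟪ξ, A (p + st.1 • v + st.2 • w)⟫ = 0) :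
    Hat A ξ k = 0 := by
  obtain ⟨R, hR⟩ := hAc.isCompact.isBounded.subset_closedBall 0
  have hA0 : ∀ x, A x ≠ 0 → ‖x‖ ≤ R := fun x hx => by
    simpa using hR (subset_tsupport A hx)
  have hvv : ⟪v, v⟫ = (1:ℝ) := by rw [real_inner_self_eq_norm_sq, hv]; norm_num
  have hww : ⟪w, w⟫ = (1:ℝ) := by rw [real_inner_self_eq_norm_sq, hw]; norm_num
  have hwv : ⟪w, v⟫ = (0:ℝ) := by rw [real_inner_comm]; exact hvw
  have bv : ∀ x : En n, |⟪x, v⟫| ≤ ‖x‖ := fun x => by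
    simpa [hv] using abs_real_inner_le_norm x v
  have bw : ∀ x : En n, |⟪x, w⟫| ≤ ‖x‖ := fun x => by
    simpa [hw] using abs_real_inner_le_norm x w
  let e : En n → ℂ := fun x => cexp (((-2 * Real.pi * ⟪x, k⟫ : ℝ) : ℂ) * I)
  have he : Continuous e := by fun_prop
  let G1 : En n → ℝ × ℝ → ℂ := fun x st =>
    e x * (((gg ⟪x, v⟫ * gg ⟪x, w⟫ : ℝ) : ℂ)) * ((⟪ξ, A (x + st.1 • v + st.2 • w)⟫ : ℝ) : ℂ)
  let G2 : En n → ℝ × ℝ → ℂ := fun y st =>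
    (e y * ((⟪ξ, A y⟫ : ℝ) : ℂ)) * ((gg (⟪y, v⟫ - st.1) * gg (⟪y, w⟫ - st.2) : ℝ) : ℂ)
  have hgc := gg_cont
  have c1 : Continuous (Function.uncurry G1) := by
    simp only [Function.uncurry_def, G1]; fun_prop
  have c2 : Continuous (Function.uncurry G2) := by
    simp only [Function.uncurry_def, G2]; fun_prop
  have hs1 : HasCompactSupport (Function.uncurry G1) := by
    refine HasCompactSupport.intro
      (isCompact_closedBall (0 : En n × (ℝ × ℝ)) (R + 2 * (R + 1))) ?_
    rintro ⟨x, s, t⟩ hx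
    by_contra hne
    apply hx
    simp only [Function.uncurry, G1, mul_eq_zero, not_or, ofReal_eq_zero] at hne
    obtain ⟨⟨-, h1, h2⟩, h3⟩ := hne
    have h1 : |⟪x, v⟫| ≤ 1 := by
      by_contra hh; exact h1 (gg_supp (not_le.1 hh))
    have h2 : |⟪x, w⟫| ≤ 1 := by
      by_contra hh; exact h2 (gg_supp (not_le.1 hh))
    have h3 : ‖x + s • v + t • w‖ ≤ R := hA0 _ (fun hh => h3 (by simp [hh]))
    have e1 := bv (x + s • v + t • w)
    have e2 := bw (x + s • v + t • w)
    simp only [inner_add_left, real_inner_smul_left, hvv, hww, hvw, hwv] at e1 e2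
    have hs : |s| ≤ R + 1 := by
      rw [abs_le] at *; constructor <;> linarith [e1.1, e1.2, h1.1, h1.2]
    have ht : |t| ≤ R + 1 := by
      rw [abs_le] at *; constructor <;> linarith [e2.1, e2.2, h2.1, h2.2]
    have hxx : ‖x‖ ≤ R + 2 * (R + 1) := by
      calc ‖x‖ = ‖(x + s • v + t • w) - s • v - t • w‖ := by congr 1; abel
        _ ≤ ‖x + s • v + t • w‖ + ‖s • v‖ + ‖t • w‖ := by
          refine (norm_sub_le _ _).trans ?_
          gcongr; exact norm_sub_le _ _
        _ ≤ _ := by simp only [norm_smul, hv, hw, Real.norm_eq_abs]; linarith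
    have hR0 : 0 ≤ R := (norm_nonneg _).trans h3
    simp only [Metric.mem_closedBall, dist_zero_right, Prod.norm_def, Real.norm_eq_abs]
    exact max_le hxx (max_le (by linarith) (by linarith))
  have hs2 : HasCompactSupport (Function.uncurry G2) := by
    refine HasCompactSupport.intro
      (isCompact_closedBall (0 : En n × (ℝ × ℝ)) (R + 1)) ?_
    rintro ⟨x, s, t⟩ hx
    by_contra hne
    apply hx
    simp only [Function.uncurry, G2, mul_eq_zero, not_or, ofReal_eq_zero] at hne
    obtain ⟨⟨-, h3⟩, h1, h2⟩ := hne
    have h1 : |⟪x, v⟫ - s| ≤ 1 := by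
      by_contra hh; exact h1 (gg_supp (not_le.1 hh))
    have h2 : |⟪x, w⟫ - t| ≤ 1 := by
      by_contra hh; exact h2 (gg_supp (not_le.1 hh))
    have h3 : ‖x‖ ≤ R := hA0 _ (fun hh => h3 (by simp [hh]))
    have e1 := bv x
    have e2 := bw x
    have hs : |s| ≤ R + 1 := by
      rw [abs_le] at *; constructor <;> linarith [e1.1, e1.2, h1.1, h1.2]
    have ht : |t| ≤ R + 1 := by
      rw [abs_le] at *; constructor <;> linarith [e2.1, e2.2, h2.1, h2.2]
    simp only [Metric.mem_closedBall, dist_zero_right, Prod.norm_def, Real.norm_eq_abs]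
    exact max_le (by linarith) (max_le hs ht)
  have E1 : ∫ x, ∫ st, G1 x st = 0 := by
    have : ∀ x, ∫ st, G1 x st = 0 := fun x => by
      simp only [G1]
      rw [integral_const_mul, integral_complex_ofReal, h x]; simp
    simp [this]
  have E2 : ∫ x, ∫ st, G1 x st = ∫ st, ∫ x, G1 x st :=
    integral_integral_swap_of_hasCompactSupport c1 hs1
  have E3 : ∀ st, ∫ x, G1 x st = ∫ y, G2 y st := fun st => by
    rw [← integral_add_right_eq_self (fun y => G2 y st) (st.1 • v + st.2 • w)]
    congr 1; ext x
    have : e (x + (st.1 • v + st.2 • w)) = e x := by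
      simp only [e, inner_add_left, real_inner_smul_left, hkv, hkw, mul_zero, add_zero]
    simp only [G1, G2, this]
    simp only [inner_add_left, real_inner_smul_left, hvv, hww, hvw, hwv, mul_zero, add_zero,
      mul_one, add_sub_cancel_right, ← add_assoc]
    ring
  have E4 : ∫ y, ∫ st, G2 y st = ∫ st, ∫ y, G2 y st :=
    integral_integral_swap_of_hasCompactSupport c2 hs2
  have E5 : ∀ y, ∫ st, G2 y st = (e y * ((⟪ξ, A y⟫ : ℝ) : ℂ)) * (((∫ x, gg x)^2 : ℝ) : ℂ) := by
    intro y
    simp only [G2]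
    rw [integral_const_mul, integral_complex_ofReal]
    congr 2
    rw [Measure.volume_eq_prod, integral_prod_mul (fun s => gg (⟪y, v⟫ - s)) (fun t => gg (⟪y, w⟫ - t)),
      integral_sub_left_eq_self, integral_sub_left_eq_self, sq]
  simp only [E5, integral_mul_const] at E4
  rw [E2] at E1
  simp only [E3] at E1
  rw [E1] at E4
  rcases mul_eq_zero.1 E4 with h' | h'
  · exact h'
  · exact absurd h' (by simpa using gg_int)

lemma hat_add {n : ℕ} (A : En n → En n) (hA : Continuous A) (hAc : HasCompactSupport A)
    (u u' k : En n) (c : ℝ) : Hat A (u + c • u') k = Hat A u k + c * Hat A u' k := by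
  have hi : ∀ u : En n, Integrable (fun x => Complex.exp (((-2 * Real.pi * ⟪x, k⟫ : ℝ) : ℂ) * Complex.I) * ((⟪u, A x⟫ : ℝ) : ℂ)) := by
    intro u
    apply Continuous.integrable_of_hasCompactSupport
    · fun_prop
    · apply HasCompactSupport.mul_left
      exact hAc.comp_left (g := fun a => ((⟪u, a⟫ : ℝ) : ℂ)) (by simp)
  unfold Hat
  rw [← integral_const_mul, ← integral_add (hi u) ((hi u').const_mul _)]
  congr 1; ext x
  simp only [inner_add_left, real_inner_smul_left]
  push_cast; ring

lemma exists_perp {n : ℕ} (hn : 3 ≤ n) (v w : En n) : ∃ k : En n, ‖k‖ = 1 ∧ ⟪v, k⟫ = 0 ∧ ⟪w, k⟫ = 0 := by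
  have : (Submodule.span ℝ ({v, w} : Set (En n)))ᗮ ≠ ⊥ := by
    intro hb
    have h1 := Submodule.finrank_add_finrank_orthogonal (Submodule.span ℝ ({v, w} : Set (En n)))
    rw [hb] at h1
    have h2 := finrank_span_finset_le_card (R := ℝ) ({v, w} : Finset (En n))
    have h3 := Finset.card_le_two (a := v) (b := w)
    simp at h1 h2
    unfold Set.finrank at h2
    omega
  obtain ⟨y, hy, hy0⟩ := Submodule.exists_mem_ne_zero_of_ne_bot this
  rw [Submodule.mem_orthogonal] at hy
  have hv := hy v (Submodule.subset_span (by simp))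
  have hw := hy w (Submodule.subset_span (by simp))
  refine ⟨‖y‖⁻¹ • y, norm_smul_inv_norm hy0, ?_, ?_⟩ <;> simp [real_inner_smul_right, hv, hw]

lemma cproj {X : Type*} [TopologicalSpace X] {n : ℕ} {f c g : X → En n} {x : X}
    (hf : ContinuousAt f x) (hc : ContinuousAt c x) (hg : ContinuousAt g x)
    (h : ⟪g x, g x⟫ ≠ (0:ℝ)) :
    ContinuousAt (fun q => f q - ((⟪c q, g q⟫ : ℝ) / (⟪g q, g q⟫ : ℝ)) • g q) x :=
  hf.sub ((ContinuousAt.div (ContinuousAt.inner hc hg) (ContinuousAt.inner hg hg) h).smul hg)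

open Filter Topology in
lemma near_hat {n : ℕ} 
    (A : En n → En n) (hA : Continuous A) (hAc : HasCompactSupport A)
    (δ : ℝ) (hδ : 0 < δ)
    (v₀ w₀ : En n) (hv₀ : ‖v₀‖ = 1) (hw₀ : ‖w₀‖ = 1) (hvw₀ : ⟪v₀, w₀⟫ = 0)
    (hplane : ∀ (p v w : En n), ‖v‖ = 1 → ‖w‖ = 1 → ⟪v, w⟫ = 0 →
      ‖v - v₀‖ < δ → ‖w - w₀‖ < δ →
      ∀ ξ ∈ Submodule.span ℝ ({v, w} : Set (En n)),
        ∫ st : ℝ × ℝ, ⟪ξ, A (p + st.1 • v + st.2 • w)⟫ = 0)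
    (k₀ : En n) (hk₀ : ‖k₀‖ = 1) (hvk : ⟪v₀, k₀⟫ = 0) (hwk : ⟪w₀, k₀⟫ = 0) :
    ∀ᶠ k in 𝓝 k₀, ∀ u, ⟪u, k⟫ = 0 → Hat A u k = 0 := by
  let V : En n × En n → En n := fun q => q.2 - (⟪q.2, q.1⟫ / ⟪q.1, q.1⟫) • q.1
  let W : En n × En n → En n := fun q => w₀ - (⟪w₀, q.1⟫ / ⟪q.1, q.1⟫) • q.1 - (⟪w₀, V q⟫ / ⟪V q, V q⟫) • V q
  have hkk : ⟪k₀, k₀⟫ = (1:ℝ) := by rw [real_inner_self_eq_norm_sq, hk₀]; norm_num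
  have hvv : ⟪v₀, v₀⟫ = (1:ℝ) := by rw [real_inner_self_eq_norm_sq, hv₀]; norm_num
  have hV0 : V (k₀, v₀) = v₀ := by simp [V, hvk]
  have hW0 : W (k₀, v₀) = w₀ := by
    simp only [W, hV0, hwk]
    rw [show ⟪w₀, v₀⟫ = (0:ℝ) by rw [real_inner_comm]; exact hvw₀]; simp
  have cV : ContinuousAt V (k₀, v₀) :=
    cproj continuousAt_snd continuousAt_snd continuousAt_fst (by rw [hkk]; norm_num)
  have cW : ContinuousAt W (k₀, v₀) :=
    cproj (cproj continuousAt_const continuousAt_const continuousAt_fst (by rw [hkk]; norm_num))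
      continuousAt_const cV (by rw [hV0, hvv]; norm_num)
  have cVn : ContinuousAt (fun q => ‖V q‖⁻¹ • V q) (k₀, v₀) :=
    (cV.norm.inv₀ (by rw [hV0, hv₀]; norm_num)).smul cV
  have cWn : ContinuousAt (fun q => ‖W q‖⁻¹ • W q) (k₀, v₀) :=
    (cW.norm.inv₀ (by rw [hW0, hw₀]; norm_num)).smul cW
  have ek : ∀ᶠ q : En n × En n in 𝓝 (k₀, v₀), q.1 ≠ 0 :=
    (continuousAt_fst (p := (k₀, v₀))).eventually_ne (by intro h; change k₀ = 0 at h; simp [h] at hk₀)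
  have eV : ∀ᶠ q in 𝓝 (k₀, v₀), V q ≠ 0 :=
    cV.eventually_ne (by rw [hV0]; intro h; simp [h] at hv₀)
  have eW : ∀ᶠ q in 𝓝 (k₀, v₀), W q ≠ 0 :=
    cW.eventually_ne (by rw [hW0]; intro h; simp [h] at hw₀)
  have eVn : ∀ᶠ q in 𝓝 (k₀, v₀), ‖‖V q‖⁻¹ • V q - v₀‖ < δ := by
    have h1 := Metric.continuousAt_iff'.1 cVn δ hδ
    simpa [hV0, hW0, hv₀, hw₀, dist_eq_norm] using h1
  have eWn : ∀ᶠ q in 𝓝 (k₀, v₀), ‖‖W q‖⁻¹ • W q - w₀‖ < δ := by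
    have h1 := Metric.continuousAt_iff'.1 cWn δ hδ
    simpa [hV0, hW0, hv₀, hw₀, dist_eq_norm] using h1
  have key : ∀ᶠ q in 𝓝 (k₀, v₀), q.1 ≠ 0 ∧ Hat A (V q) q.1 = 0 := by
    filter_upwards [ek, eV, eW, eVn, eWn] with q h1 h2 h3 h4 h5
    refine ⟨h1, ?_⟩
    have i1 : ⟪q.1, q.1⟫ ≠ (0:ℝ) := by simpa using h1
    have i2 : ⟪V q, V q⟫ ≠ (0:ℝ) := by simpa using h2
    have vk : ⟪V q, q.1⟫ = (0:ℝ) := by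
      simp only [V, inner_sub_left, real_inner_smul_left]; field_simp; simp
    have wk : ⟪W q, q.1⟫ = (0:ℝ) := by
      simp only [W, inner_sub_left, real_inner_smul_left, vk]; field_simp; simp
    have vw : ⟪W q, V q⟫ = (0:ℝ) := by
      simp only [W, inner_sub_left, real_inner_smul_left]
      rw [real_inner_comm (V q) q.1, vk]; field_simp; simp
    have n1 : ‖‖V q‖⁻¹ • V q‖ = 1 := norm_smul_inv_norm h2
    have n2 : ‖‖W q‖⁻¹ • W q‖ = 1 := norm_smul_inv_norm h3
    have o : ⟪‖V q‖⁻¹ • V q, ‖W q‖⁻¹ • W q⟫ = (0:ℝ) := by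
      rw [real_inner_smul_left, real_inner_smul_right, real_inner_comm, vw]; simp
    refine plane_hat A hA hAc (‖V q‖⁻¹ • V q) (‖W q‖⁻¹ • W q) q.1 (V q) n1 n2 o
      (by rw [real_inner_smul_left, vk, mul_zero]) (by rw [real_inner_smul_left, wk, mul_zero])
      (fun p => hplane p _ _ n1 n2 o h4 h5 _ ?_)
    have : V q = ‖V q‖ • (‖V q‖⁻¹ • V q) := by
      rw [smul_smul, mul_inv_cancel₀ (by simpa using h2), one_smul]
    rw [this]
    exact Submodule.smul_mem _ _ (Submodule.subset_span (by rw [← this]; simp))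
  rw [nhds_prod_eq] at key
  filter_upwards [key.curry] with k hk u hu
  have hb := hk.self_of_nhds
  have hc : Tendsto (fun c : ℝ => v₀ + c • u) (𝓝 0) (𝓝 v₀) := by
    have : Continuous (fun c : ℝ => v₀ + c • u) := by fun_prop
    simpa using this.tendsto 0
  obtain ⟨c, hc1, hc0⟩ := (((hc.eventually hk).filter_mono nhdsWithin_le_nhds).and
    (eventually_mem_nhdsWithin (s := {0}ᶜ) (a := (0:ℝ)))).exists
  have hVu : V (k, v₀ + c • u) = V (k, v₀) + c • u := by
    simp only [V, inner_add_left, real_inner_smul_left, hu]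
    simp; abel
  have h2 := hc1.2
  rw [hVu, hat_add A hA hAc] at h2
  have hb2 : Hat A (V (k, v₀)) k = 0 := hb.2
  rw [hb2, zero_add] at h2
  exact (mul_eq_zero.1 h2).resolve_left (by simpa using hc0)

open Complex in
lemma entire {n : ℕ} (f : En n → ℝ) (hf : Continuous f) (hfc : HasCompactSupport f) (a m : En n) :
    Differentiable ℂ (fun z : ℂ => ∫ x, cexp ((((-2 * Real.pi * ⟪x, a⟫ : ℝ) : ℂ) +
      z * ((-2 * Real.pi * ⟪x, m⟫ : ℝ) : ℂ)) * I) * (f x : ℂ)) := by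
  intro z₀
  let F' : ℂ → En n → ℂ := fun z x => cexp ((((-2 * Real.pi * ⟪x, a⟫ : ℝ) : ℂ) +
      z * ((-2 * Real.pi * ⟪x, m⟫ : ℝ) : ℂ)) * I) * (((-2 * Real.pi * ⟪x, m⟫ : ℝ) : ℂ) * I) * (f x : ℂ)
  let b : En n → ℝ := fun x => Real.exp ((‖z₀‖ + 1) * |2 * Real.pi * ⟪x, m⟫|) * |2 * Real.pi * ⟪x, m⟫| * |f x|
  refine (hasDerivAt_integral_of_dominated_loc_of_deriv_le (F' := F') (bound := b)
    (Metric.ball_mem_nhds z₀ one_pos) ?_ ?_ ?_ ?_ ?_ ?_).2.differentiableAt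
  · refine Filter.Eventually.of_forall fun z => Continuous.aestronglyMeasurable (by fun_prop)
  · apply Continuous.integrable_of_hasCompactSupport
    · fun_prop
    · exact HasCompactSupport.mul_left (hfc.comp_left (g := fun a : ℝ => (a : ℂ)) (by simp))
  · exact Continuous.aestronglyMeasurable (by fun_prop)
  · refine Filter.Eventually.of_forall fun x z hz => ?_
    simp only [F', b, norm_mul (_ : ℂ), Complex.norm_exp, Complex.norm_real, Complex.norm_I, mul_one]
    have hz' : ‖z‖ ≤ ‖z₀‖ + 1 := by
      have := norm_le_norm_add_norm_sub' z z₀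
      rw [Metric.mem_ball, dist_eq_norm] at hz
      linarith
    have e1 : (2 * Real.pi * ⟪x, m⟫) = - (-2 * Real.pi * ⟪x, m⟫) := by ring
    rw [e1, abs_neg]
    generalize -2 * Real.pi * ⟪x, m⟫ = r
    generalize -2 * Real.pi * ⟪x, a⟫ = s
    have e2 : (((s : ℂ) + z * (r : ℂ)) * I).re = - (z.im * r) := by simp
    rw [e2]
    simp only [Real.norm_eq_abs]
    gcongr
    calc -(z.im * r) ≤ |z.im * r| := neg_le_abs _
      _ = |z.im| * |r| := abs_mul _ _
      _ ≤ _ := by gcongr; exact (Complex.abs_im_le_norm z).trans hz'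
  · apply Continuous.integrable_of_hasCompactSupport
    · fun_prop
    · exact HasCompactSupport.mul_left (hfc.comp_left (g := fun a : ℝ => |a|) (by simp))
  · refine Filter.Eventually.of_forall fun x z _ => ?_
    have h1 : HasDerivAt (fun z : ℂ => (((-2 * Real.pi * ⟪x, a⟫ : ℝ) : ℂ) +
      z * ((-2 * Real.pi * ⟪x, m⟫ : ℝ) : ℂ)) * I) (((-2 * Real.pi * ⟪x, m⟫ : ℝ) : ℂ) * I) z := by
      have := (((hasDerivAt_id z).mul_const ((-2 * Real.pi * ⟪x, m⟫ : ℝ) : ℂ)).const_add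
        ((-2 * Real.pi * ⟪x, a⟫ : ℝ) : ℂ)).mul_const I
      simpa using this
    exact h1.cexp.mul_const _

open Filter Topology in
lemma all_hat {n : ℕ} 
    (A : En n → En n) (hA : Continuous A) (hAc : HasCompactSupport A) (k₀ : En n)
    (h : ∀ᶠ k in 𝓝 k₀, ∀ u, ⟪u, k⟫ = 0 → Hat A u k = 0) (k : En n) (i j : Fin n) :
    (k i : ℂ) * Hat A (EuclideanSpace.single j 1) k - (k j : ℂ) * Hat A (EuclideanSpace.single i 1) k = 0 := by
  let m := k - k₀
  let ff : En n → ℂ → ℂ := fun u z => ∫ x, Complex.exp ((((-2 * Real.pi * ⟪x, k₀⟫ : ℝ) : ℂ) +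
      z * ((-2 * Real.pi * ⟪x, m⟫ : ℝ) : ℂ)) * Complex.I) * ((⟪u, A x⟫ : ℝ) : ℂ)
  have hff : ∀ u, Differentiable ℂ (ff u) := fun u =>
    entire (fun x => ⟪u, A x⟫) (by fun_prop) (hAc.comp_left (g := fun a => (⟪u, a⟫ : ℝ)) (by simp)) k₀ m
  have hfr : ∀ u (t : ℝ), ff u t = Hat A u (k₀ + t • m) := fun u t => by
    simp only [ff, Hat]
    congr 1; ext x
    congr 3
    rw [inner_add_right, real_inner_smul_right]; push_cast; ring
  let F : ℂ → ℂ := fun z => ((k₀ i : ℂ) + z * (m i : ℂ)) * ff (EuclideanSpace.single j 1) z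
    - ((k₀ j : ℂ) + z * (m j : ℂ)) * ff (EuclideanSpace.single i 1) z
  have hF : Differentiable ℂ F := by
    have := hff (EuclideanSpace.single j 1)
    have := hff (EuclideanSpace.single i 1)
    fun_prop
  have hFr : ∀ t : ℝ, F t = (((k₀ + t • m) i : ℝ) : ℂ) * Hat A (EuclideanSpace.single j 1) (k₀ + t • m) -
      (((k₀ + t • m) j : ℝ) : ℂ) * Hat A (EuclideanSpace.single i 1) (k₀ + t • m) := fun t => by
    simp only [F, hfr]
    simp
  have hz : ∀ᶠ t : ℝ in 𝓝 0, F t = 0 := by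
    have hc : Tendsto (fun t : ℝ => k₀ + t • m) (𝓝 0) (𝓝 k₀) := by
      have : Continuous (fun t : ℝ => k₀ + t • m) := by fun_prop
      simpa using this.tendsto 0
    filter_upwards [hc.eventually h] with t ht
    rw [hFr]
    generalize k₀ + t • m = q at ht
    have := ht (q i • EuclideanSpace.single j 1 + (-q j) • EuclideanSpace.single i 1) (by
      simp [inner_add_left, real_inner_smul_left, EuclideanSpace.inner_single_left]; ring)
    have h0 : Hat A 0 q = 0 := by simp [Hat]
    have h1 := hat_add A hA hAc 0 (EuclideanSpace.single j 1) q (q i)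
    rw [hat_add A hA hAc, ← zero_add (q i • _), h1, h0] at this
    push_cast at this
    linear_combination this
  have hfreq : ∃ᶠ z in 𝓝[≠] (0:ℂ), F z = (fun _ => 0) z := by
    have ht : Tendsto (fun t : ℝ => (t : ℂ)) (𝓝[≠] 0) (𝓝[≠] 0) := by
      refine tendsto_nhdsWithin_of_tendsto_nhds_of_eventually_within _ ?_ ?_
      · have := Complex.continuous_ofReal.tendsto 0
        simp only [Complex.ofReal_zero] at this
        exact this.mono_left nhdsWithin_le_nhds
      · filter_upwards [self_mem_nhdsWithin] with t ht
        simpa using ht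
    exact ht.frequently (hz.filter_mono nhdsWithin_le_nhds : ∀ᶠ t : ℝ in 𝓝[≠] (0:ℝ), F t = 0).frequently
  have := AnalyticOnNhd.eq_of_frequently_eq
    (fun z _ => hF.analyticAt z) (fun z _ => analyticAt_const) hfreq
  have h1 := hFr 1
  rw [this] at h1
  simp only [one_smul, m, add_sub_cancel] at h1
  exact h1.symm

open FourierTransform LineDeriv SchwartzMap in
lemma fin_hat {n : ℕ} (A : En n → En n) (hA : Continuous A) (hAc : HasCompactSupport A)
    (χ : 𝓢(En n, ℂ)) (i j : Fin n) :
    ∫ x, ((A x j : ℝ) : ℂ) * fderiv ℝ χ x (EuclideanSpace.single i 1) =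
    ∫ k, -(2 * Real.pi * Complex.I) * (𝓕⁻ χ k) * ((k i : ℂ) * Hat A (EuclideanSpace.single j 1) k) := by
  have hg : ((inner ℝ · (EuclideanSpace.single i 1 : En n)) : En n → ℝ).HasTemperateGrowth := by fun_prop
  let f : En n → ℂ := fun x => ((A x j : ℝ) : ℂ)
  have hf : Integrable f := by
    apply Continuous.integrable_of_hasCompactSupport
    · fun_prop
    · exact hAc.comp_left (g := fun a : En n => ((a j : ℝ) : ℂ)) (by simp)
  let D : 𝓢(En n, ℂ) := ∂_{(EuclideanSpace.single i 1 : En n)} χ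
  have h1 : ∀ x, fderiv ℝ χ x (EuclideanSpace.single i 1) = 𝓕 (𝓕⁻ D) x := by
    intro x
    rw [FourierTransform.fourier_fourierInv_eq]
    exact (lineDerivOp_apply_eq_fderiv _ _ _).symm
  have h2 : ∀ k, 𝓕⁻ D k = -(2 * Real.pi * Complex.I) * ((k i : ℂ) * 𝓕⁻ χ k) := by
    intro k
    simp only [D]
    rw [fourierInv_lineDerivOp_eq]
    rw [_root_.smul_apply, smulLeftCLM_apply_apply hg]
    simp [EuclideanSpace.inner_single_right]
  have h3 : ∀ k, 𝓕 f k = Hat A (EuclideanSpace.single j 1) k := by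
    intro k
    rw [Real.fourier_eq']
    simp [Hat, f, EuclideanSpace.inner_single_left]
  have h4 : ∫ k, 𝓕 f k • (𝓕⁻ D) k = ∫ x, f x • 𝓕 (𝓕⁻ D) x := by
    have := VectorFourier.integral_fourierIntegral_smul_eq_flip (L := innerₗ (En n)) (μ := volume)
      (ν := volume) Real.continuous_fourierChar continuous_inner hf (𝓕⁻ D).integrable
    rw [flip_innerₗ] at this
    exact this
  simp only [h1]
  refine h4.symm.trans ?_
  congr 1; ext k
  rw [h3, h2, smul_eq_mul]; ring

/-- If a continuous compactly supported vector field `A` on `ℝⁿ` (`n ≥ 3`) has vanishing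
integrals `∫_P ξ·A dλ_P = 0` over all affine 2-planes `P` whose direction is within `δ`
of a fixed 2-plane direction (and all tangent vectors `ξ`), then `dA = 0` in the sense of
distributions. -/
theorem vanishing_plane_integrals_imply_closed {n : ℕ} (hn : 3 ≤ n)
    (A : En n → En n) (hA : Continuous A) (hAc : HasCompactSupport A)
    (δ : ℝ) (hδ : 0 < δ)
    (v₀ w₀ : En n) (hv₀ : ‖v₀‖ = 1) (hw₀ : ‖w₀‖ = 1) (hvw₀ : ⟪v₀, w₀⟫ = 0)
    (hplane : ∀ (p v w : En n), ‖v‖ = 1 → ‖w‖ = 1 → ⟪v, w⟫ = 0 →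
      ‖v - v₀‖ < δ → ‖w - w₀‖ < δ →
      ∀ ξ ∈ Submodule.span ℝ ({v, w} : Set (En n)),
        ∫ st : ℝ × ℝ, ⟪ξ, A (p + st.1 • v + st.2 • w)⟫ = 0) :
    -- `dA = 0` distributionally: `∫ (A_j ∂_i χ - A_i ∂_j χ) = 0` for all test functions `χ`
    ∀ χ : En n → ℝ, ContDiff ℝ (⊤ : ℕ∞) χ → HasCompactSupport χ →
      ∀ i j : Fin n, ∫ x, (A x j * pdR i χ x - A x i * pdR j χ x) = 0 := by
  intro χ hχ hχc i j
  obtain ⟨k₀, hk₀, hvk, hwk⟩ := exists_perp hn v₀ w₀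
  have H := all_hat A hA hAc k₀
    (near_hat A hA hAc δ hδ v₀ w₀ hv₀ hw₀ hvw₀ hplane k₀ hk₀ hvk hwk)
  have hcc : HasCompactSupport (fun x => (χ x : ℂ)) :=
    hχc.comp_left (g := fun a : ℝ => (a : ℂ)) (by simp)
  let S : SchwartzMap (En n) ℂ := hcc.toSchwartzMap
    (Complex.ofRealCLM.contDiff.comp hχ)
  have hS : ∀ x i, fderiv ℝ S x (EuclideanSpace.single i 1) = ((pdR i χ x : ℝ) : ℂ) := by
    intro x i
    have h1 : HasFDerivAt χ (fderiv ℝ χ x) x :=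
      ((hχ.differentiable (by simp)) x).hasFDerivAt
    have h2 : HasFDerivAt S (Complex.ofRealCLM.comp (fderiv ℝ χ x)) x :=
      Complex.ofRealCLM.hasFDerivAt.comp x h1
    rw [h2.fderiv]; rfl
  have hint : ∀ i j : Fin n, Integrable (fun x => A x j * pdR i χ x) := by
    intro i j
    have hc : Continuous (pdR i χ) := by
      unfold pdR
      exact (hχ.continuous_fderiv (by simp)).clm_apply continuous_const
    apply Continuous.integrable_of_hasCompactSupport
    · fun_prop
    · exact HasCompactSupport.mul_right
        (hAc.comp_left (g := fun a : En n => a j) (by simp))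
  have hr : ∀ i j : Fin n, ((∫ x, A x j * pdR i χ x : ℝ) : ℂ) =
      ∫ x, ((A x j : ℝ) : ℂ) * fderiv ℝ S x (EuclideanSpace.single i 1) := by
    intro i j
    rw [← integral_complex_ofReal]
    congr 1; ext x
    rw [hS]; push_cast; rfl
  rw [integral_sub (hint i j) (hint j i), sub_eq_zero]
  apply Complex.ofReal_injective
  rw [hr, hr, fin_hat A hA hAc, fin_hat A hA hAc]
  congr 1; ext k
  rw [sub_eq_zero.1 (H k i j)]
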